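/- For every field F of a phase of the algorithm TC, the number of requests lying in the slots of F satisfies req(F) = size(F)·α; moreover, all these requests are positive if F is a positive field and all are negative if F is a negative field. -/

import Mathlib

open scoped Classical

/-!
Common setup for the online tree caching problem
(Bienkowski, Marcinkowski, Pacut, Schmid, Spyra, "Online Tree Caching").
-/

/-- A finite rooted tree on the vertex type `V`: every vertex has a parent,
the root is its own parent, and iterating `parent` from any vertex reaches the root. -/
structure RTree (V : Type) where
  root : V
  parent : V → V
  parent_root : parent root = root
  reaches_root : ∀ v : V, ∃ n : ℕ, parent^[n] v = root

namespace RTree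

variable {V : Type}

/-- The subtree `T(u)`: `u` together with all its descendants. -/
def subtree (T : RTree V) (u : V) : Set V :=
  {v | ∃ n : ℕ, T.parent^[n] v = u}

/-- `C` is a subforest of `T`: with every node it contains the whole subtree below it. -/
def Subforest (T : RTree V) (C : Set V) : Prop :=
  ∀ v ∈ C, T.subtree v ⊆ C

/-- `A` is a tree cap rooted at `v`: `A ⊆ T(v)`, `v ∈ A`, and `A` is closed under
taking the parent (towards `v`). -/
def TreeCap (T : RTree V) (v : V) (A : Set V) : Prop :=
  A ⊆ T.subtree v ∧ v ∈ A ∧ ∀ u ∈ A, u ≠ v → T.parent u ∈ A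

/-- `X` is a valid positive changeset for the cache `C`. -/
def ValidPos (T : RTree V) (C X : Set V) : Prop :=
  X.Nonempty ∧ X ∩ C = ∅ ∧ T.Subforest (C ∪ X)

/-- `X` is a valid negative changeset for the cache `C`. -/
def ValidNeg (T : RTree V) (C X : Set V) : Prop :=
  X.Nonempty ∧ X ⊆ C ∧ T.Subforest (C \ X)

/-- `X` is a valid changeset for the cache `C`. -/
def Valid (T : RTree V) (C X : Set V) : Prop :=
  T.ValidPos C X ∨ T.ValidNeg C X

/-- `w` is the root of a tree (connected component) of the subforest `C`. -/
def IsCompRoot (T : RTree V) (C : Set V) (w : V) : Prop :=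
  w ∈ C ∧ (w = T.root ∨ T.parent w ∉ C)

/-- The depth of a node: its distance to the root. -/
noncomputable def depth [DecidableEq V] (T : RTree V) (v : V) : ℕ :=
  Nat.find (T.reaches_root v)

/-- The height `h(T)` of the tree: its number of levels. -/
noncomputable def height [Fintype V] [DecidableEq V] (T : RTree V) : ℕ :=
  (Finset.univ.sup fun v => T.depth v) + 1

end RTree

/-- A request: a node together with a sign (`true` = positive, `false` = negative). -/
abbrev Request (V : Type) := V × Bool

/-- The request `r` incurs cost `1` when the cache is `C`
(a positive request to a non-cached node, or a negative request to a cached node). -/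
def Costly {V : Type} (r : Request V) (C : Set V) : Prop :=
  (r.2 = true ∧ r.1 ∉ C) ∨ (r.2 = false ∧ r.1 ∈ C)

/-- The sum of the counters `f` over the set of nodes `A`. -/
noncomputable def cntSum {V : Type} [Fintype V] (f : V → ℕ) (A : Set V) : ℕ :=
  ∑ v : V, A.indicator f v

/-- The number of nodes of a changeset (`0` for no changeset). -/
noncomputable def chgSize {V : Type} : Option (Set V) → ℕ
  | none => 0
  | some X => X.ncard

/-- One phase of the algorithm `TC` on the request sequence `req` (the request of
round `t ≥ 1` is `req t`), starting at time `0` with an empty cache.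
`cache t` is the cache contents during round `t`; `cnt t` are the counter values just
after serving the request of round `t` (used for the decision at time `t`);
`chg t` is the changeset applied at time `t` (right after round `t`), if any. -/
structure TCPhase {V : Type} [Fintype V] [DecidableEq V]
    (T : RTree V) (α : ℕ) (req : ℕ → Request V) where
  cache : ℕ → Set V
  cnt : ℕ → V → ℕ
  chg : ℕ → Option (Set V)
  cache_subforest : ∀ t, T.Subforest (cache t)
  cache_zero : cache 0 = ∅
  cnt_zero : ∀ v, cnt 0 v = 0
  cnt_rec : ∀ t v, cnt (t + 1) v =
    (if ∃ X, chg t = some X ∧ v ∈ X then 0 else cnt t v)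
    + (if (req (t + 1)).1 = v ∧ Costly (req (t + 1)) (cache (t + 1)) then 1 else 0)
  step_some : ∀ t X, chg t = some X →
    T.Valid (cache t) X ∧
    X.ncard * α ≤ cntSum (cnt t) X ∧
    (∀ Y, T.Valid (cache t) Y → X ⊂ Y → cntSum (cnt t) Y < Y.ncard * α) ∧
    cache (t + 1) = if T.ValidPos (cache t) X then cache t ∪ X else cache t \ X
  step_none : ∀ t, chg t = none →
    cache (t + 1) = cache t ∧
    ∀ X, T.Valid (cache t) X → cntSum (cnt t) X < X.ncard * α

namespace TCPhase

variable {V : Type} [Fintype V] [DecidableEq V]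
  {T : RTree V} {α : ℕ} {req : ℕ → Request V}

/-- The counter values at time `t`, right after the cache change at time `t`
(counters of fetched/evicted nodes are reset to `0`). -/
noncomputable def cntPost (E : TCPhase T α req) (t : ℕ) (v : V) : ℕ :=
  if ∃ X, E.chg t = some X ∧ v ∈ X then 0 else E.cnt t v

/-- `last_v(t)`: the last time strictly before `t` at which `v` changed its
cached/non-cached state (`0`, the beginning of the phase, if there is none). -/
noncomputable def lastChg (E : TCPhase T α req) (v : V) (t : ℕ) : ℕ :=
  ((Finset.range t).filter fun s => ¬ ((v ∈ E.cache s) ↔ v ∈ E.cache (s + 1))).sup id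

/-- The slot `(v, r)` belongs to the field `F^t`. -/
def inField (E : TCPhase T α req) (t : ℕ) (v : V) (r : ℕ) : Prop :=
  ∃ X, E.chg t = some X ∧ v ∈ X ∧ E.lastChg v t < r ∧ r ≤ t

/-- The number of requests of the sequence `ρ` lying in slots of `F^t_{≤ τ} ∩ D`. -/
noncomputable def fieldReqIn (E : TCPhase T α req) (ρ : ℕ → Request V)
    (t : ℕ) (D : Set V) (τ : ℕ) : ℕ :=
  ((Finset.Icc 1 t).filter fun r => r ≤ τ ∧ (ρ r).1 ∈ D ∧ E.inField t (ρ r).1 r).card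

/-- `req(F^t)`: the number of requests of `ρ` in slots of the field `F^t`. -/
noncomputable def fieldReq (E : TCPhase T α req) (ρ : ℕ → Request V) (t : ℕ) : ℕ :=
  E.fieldReqIn ρ t Set.univ t

/-- `size(F^t_{≤ τ} ∩ D)`: the number of distinct nodes having a slot in `F^t_{≤ τ} ∩ D`. -/
noncomputable def fieldSizeIn (E : TCPhase T α req) (t : ℕ) (D : Set V) (τ : ℕ) : ℕ :=
  (Finset.univ.filter fun v : V => v ∈ D ∧ ∃ r, r ≤ τ ∧ E.inField t v r).card

/-- The standing assumption: no positive requests are given to cached nodes and no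
negative requests to non-cached ones (so every request incurs cost `1` for `TC`). -/
def GoodReq (E : TCPhase T α req) : Prop :=
  ∀ t, 1 ≤ t →
    ((req t).2 = true → (req t).1 ∉ E.cache t) ∧
    ((req t).2 = false → (req t).1 ∈ E.cache t)

/-- The phase consists of rounds `1, …, tEnd`: no cache of `TC` before time `tEnd`
exceeds the capacity `kONL` (at time `tEnd` the triggered fetch, if any, is performed
even if it exceeds the capacity, and is followed by the final eviction). -/
def PhaseEnd (E : TCPhase T α req) (kONL tEnd : ℕ) : Prop :=
  ∀ t, t < tEnd → (E.cache (t + 1)).ncard ≤ kONL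

/-- `k_P`: the number of nodes in `TC`'s cache at the end of the phase
(after the fetch at time `tEnd`, before the final eviction). -/
noncomputable def kP (E : TCPhase T α req) (tEnd : ℕ) : ℕ :=
  (E.cache (tEnd + 1)).ncard

/-- The phase ending at `tEnd` is finished: the fetch at time `tEnd` exceeded the
capacity `kONL`. -/
def FinishedAt (E : TCPhase T α req) (kONL tEnd : ℕ) : Prop :=
  E.PhaseEnd kONL tEnd ∧ kONL < E.kP tEnd

/-- `size(𝓕)`: the total size of all fields of the phase. -/
noncomputable def sizeFields (E : TCPhase T α req) (tEnd : ℕ) : ℕ :=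
  ∑ t ∈ Finset.Icc 1 tEnd, chgSize (E.chg t)

/-- `req(F^∞)`: the number of requests of the phase lying in slots of the open field
(slots covered by no field of the phase). -/
noncomputable def openReq (E : TCPhase T α req) (tEnd : ℕ) : ℕ :=
  ((Finset.Icc 1 tEnd).filter fun r => ∀ t, t ≤ tEnd → ¬ E.inField t (req r).1 r).card

/-- `TC(P)`: the total cost paid by `TC` during the phase: serving the requests,
fetching/evicting the applied changesets (`α` per node), and the final eviction
(`α · k_P`) if the phase is finished. -/
noncomputable def tcCost (E : TCPhase T α req) (kONL tEnd : ℕ) : ℕ :=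
  ((Finset.Icc 1 tEnd).filter fun r => Costly (req r) (E.cache r)).card
  + α * E.sizeFields tEnd
  + (if kONL < E.kP tEnd then α * E.kP tEnd else 0)

/-- The tree cap `Y` (rooted at `u`, inside the negative field `F^t`) is proper for
the request sequence `ρ`: it holds `req(F^t ∩ Y) = |Y| · α`, and `F^t_{≤ τ} ∩ D` is
not over-requested for every tree cap `D ⊆ Y` rooted at `u` and every time `τ ≤ t`. -/
def Proper (E : TCPhase T α req) (ρ : ℕ → Request V) (t : ℕ) (u : V) (Y : Set V) : Prop :=
  E.fieldReqIn ρ t Y t = Y.ncard * α ∧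
  ∀ (D : Set V) (τ : ℕ), T.TreeCap u D → D ⊆ Y → τ ≤ t →
    E.fieldReqIn ρ t D τ ≤ E.fieldSizeIn t D τ * α

end TCPhase

/-- `D` is a feasible cache schedule for an (offline) algorithm with cache size `k`:
at every time the cache is a subforest of `T` of at most `k` nodes. -/
def IsSchedule {V : Type} (T : RTree V) (k : ℕ) (D : ℕ → Set V) : Prop :=
  ∀ t, T.Subforest (D t) ∧ (D t).ncard ≤ k

/-- The cost of serving the requests of rounds `a, …, b` of `ρ` when the cache during
round `r` is `D r`. -/
noncomputable def serveCost {V : Type} (ρ : ℕ → Request V) (D : ℕ → Set V) (a b : ℕ) : ℕ :=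
  ((Finset.Icc a b).filter fun r => Costly (ρ r) (D r)).card

/-- The reorganization cost of the schedule `D` (`α` per fetched or evicted node) over
the times `a, …, b - 1` (the change at time `t` leads from `D t` to `D (t+1)`). -/
noncomputable def moveCost {V : Type} (α : ℕ) (D : ℕ → Set V) (a b : ℕ) : ℕ :=
  α * ∑ t ∈ Finset.Ico a b, ((D (t + 1) \ D t).ncard + (D t \ D (t + 1)).ncard)

/-- `OPT`: the minimum cost of serving rounds `a, …, b` of `ρ` by an offline algorithm
with cache size `k` that may start with an arbitrary cache. -/
noncomputable def optCostFrom {V : Type} (T : RTree V) (α k : ℕ)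
    (ρ : ℕ → Request V) (a b : ℕ) : ℕ :=
  sInf {n | ∃ D : ℕ → Set V, IsSchedule T k D ∧
    n = serveCost ρ D a b + moveCost α D a b}

/-- `OPT`: the minimum cost of serving rounds `1, …, b` of `ρ` by an offline algorithm
with cache size `k` that starts with the empty cache. -/
noncomputable def optCostEmpty {V : Type} (T : RTree V) (α k : ℕ)
    (ρ : ℕ → Request V) (b : ℕ) : ℕ :=
  sInf {n | ∃ D : ℕ → Set V, IsSchedule T k D ∧ D 0 = ∅ ∧
    n = serveCost ρ D 1 b + moveCost α D 0 b}

/-- `ρ'` is obtained from `ρ` by legally shifting requests: signs are preserved, every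
positive request is moved to a descendant of its node (or kept), and every negative
request is moved to an ancestor of its node (or kept). -/
def LegalShift {V : Type} (T : RTree V) (ρ ρ' : ℕ → Request V) : Prop :=
  ∀ t, (ρ' t).2 = (ρ t).2 ∧
    ((ρ t).2 = true → (ρ' t).1 ∈ T.subtree (ρ t).1) ∧
    ((ρ t).2 = false → (ρ t).1 ∈ T.subtree (ρ' t).1)

/-- A full run of the algorithm `TC` with cache capacity `kONL` on the request
sequence `req`, including phase restarts: whenever the fetch of a saturated changeset
would exceed the capacity, `TC` instead evicts its whole cache and a new phase starts
(`newPhase t` holds, and all counters are reset). -/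
structure TCRun {V : Type} [Fintype V] [DecidableEq V]
    (T : RTree V) (α kONL : ℕ) (req : ℕ → Request V) where
  cache : ℕ → Set V
  cnt : ℕ → V → ℕ
  chg : ℕ → Option (Set V)
  newPhase : ℕ → Prop
  cache_subforest : ∀ t, T.Subforest (cache t)
  cache_zero : cache 0 = ∅
  cnt_zero : ∀ v, cnt 0 v = 0
  capacity : ∀ t, (cache t).ncard ≤ kONL
  cnt_rec : ∀ t v, cnt (t + 1) v =
    (if newPhase t ∨ ∃ X, chg t = some X ∧ v ∈ X then 0 else cnt t v)
    + (if (req (t + 1)).1 = v ∧ Costly (req (t + 1)) (cache (t + 1)) then 1 else 0)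
  step_some : ∀ t X, chg t = some X →
    T.Valid (cache t) X ∧
    X.ncard * α ≤ cntSum (cnt t) X ∧
    (∀ Y, T.Valid (cache t) Y → X ⊂ Y → cntSum (cnt t) Y < Y.ncard * α) ∧
    ((T.ValidPos (cache t) X ∧ (cache t ∪ X).ncard ≤ kONL ∧
        cache (t + 1) = cache t ∪ X ∧ ¬ newPhase t) ∨
     (T.ValidPos (cache t) X ∧ kONL < (cache t ∪ X).ncard ∧
        cache (t + 1) = ∅ ∧ newPhase t) ∨
     (T.ValidNeg (cache t) X ∧ cache (t + 1) = cache t \ X ∧ ¬ newPhase t))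
  step_none : ∀ t, chg t = none →
    cache (t + 1) = cache t ∧ ¬ newPhase t ∧
    ∀ X, T.Valid (cache t) X → cntSum (cnt t) X < X.ncard * α

/-- `TC(I)`: the total cost paid by the run `E` of `TC` on the rounds `1, …, N`:
serving the requests, plus `α` per fetched/evicted node (on a phase restart the whole
cache is evicted). -/
noncomputable def TCRun.cost {V : Type} [Fintype V] [DecidableEq V]
    {T : RTree V} {α kONL : ℕ} {req : ℕ → Request V}
    (E : TCRun T α kONL req) (N : ℕ) : ℕ :=
  ((Finset.Icc 1 N).filter fun r => Costly (req r) (E.cache r)).card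
  + α * ∑ t ∈ Finset.Icc 1 N,
      (if E.newPhase t then (E.cache t).ncard else chgSize (E.chg t))

theorem cntSum_union {V : Type} [Fintype V] (f : V → ℕ) {A B : Set V} (h : Disjoint A B) :
    cntSum f (A ∪ B) = cntSum f A + cntSum f B := by
  unfold cntSum
  rw [Set.indicator_union_of_disjoint h, ← Finset.sum_add_distrib]

theorem cntSum_congr {V : Type} [Fintype V] {f g : V → ℕ} {A : Set V}
    (h : ∀ v ∈ A, f v = g v) : cntSum f A = cntSum g A := by
  unfold cntSum
  rw [Set.indicator_congr h]

theorem cntSum_eq_zero {V : Type} [Fintype V] {f : V → ℕ} {A : Set V}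
    (h : ∀ v ∈ A, f v = 0) : cntSum f A = 0 := by
  unfold cntSum
  exact Finset.sum_eq_zero fun v _ => Set.indicator_apply_eq_zero.2 (h v)

theorem cntSum_add {V : Type} [Fintype V] (f g : V → ℕ) (A : Set V) :
    cntSum (fun v => f v + g v) A = cntSum f A + cntSum g A := by
  unfold cntSum
  rw [← Finset.sum_add_distrib]
  exact Finset.sum_congr rfl fun v _ => by rw [Set.indicator_add]

theorem cntSum_single {V : Type} [Fintype V] [DecidableEq V] (w : V) (A : Set V) :
    cntSum (fun v => if w = v then 1 else 0) A = if w ∈ A then 1 else 0 := by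
  unfold cntSum
  simp only [Set.indicator_apply]
  rw [Finset.sum_eq_single w]
  · simp
  · intro b _ hb
    simp [hb.symm]
  · simp

namespace RTree

variable {V : Type} {T : RTree V} {C X Y : Set V}

theorem Subforest.inter (hC : T.Subforest C) (hX : T.Subforest X) : T.Subforest (C ∩ X) :=
  fun v hv => Set.subset_inter (hC v hv.1) (hX v hv.2)

theorem Subforest.union (hC : T.Subforest C) (hX : T.Subforest X) : T.Subforest (C ∪ X) :=
  fun v hv => hv.elim (fun h => (hC v h).trans Set.subset_union_left)
    (fun h => (hX v h).trans Set.subset_union_right)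

theorem Valid.nonempty (h : T.Valid C X) : X.Nonempty := h.elim (·.1) (·.1)

theorem ValidPos.not_validNeg (h : T.ValidPos C X) : ¬ T.ValidNeg C X := by
  rintro ⟨⟨v, hv⟩, hs, -⟩
  exact (Set.ext_iff.1 h.2.1 v).1 ⟨hv, hs hv⟩

/-- The cache resulting from applying the changeset `X` to the cache `C`. -/
noncomputable def applyChg (T : RTree V) (C X : Set V) : Set V :=
  if T.ValidPos C X then C ∪ X else C \ X

theorem mem_applyChg_iff (h : T.Valid C X) (v : V) :
    v ∈ T.applyChg C X ↔ if v ∈ X then v ∉ C else v ∈ C := by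
  unfold applyChg
  rcases h with h | h
  · have := Set.ext_iff.1 h.2.1 v
    rw [if_pos h]
    by_cases hv : v ∈ X <;> simp_all
  · have := @h.2.1 v
    rw [if_neg fun h' => h'.not_validNeg h]
    by_cases hv : v ∈ X <;> simp_all

/-- After applying `X`, a valid changeset `Y` either extends `X` to a larger valid changeset,
or its part outside `X` was already valid beforehand. -/
theorem Valid.of_applyChg (hC : T.Subforest C) (hX : T.Valid C X)
    (hY : T.Valid (T.applyChg C X) Y) :
    (Disjoint X Y ∧ T.Valid C (X ∪ Y)) ∨ (Y \ X = ∅ ∨ T.Valid C (Y \ X)) := by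
  unfold applyChg at hY
  rcases hX with hX | hX
  · rw [if_pos hX] at hY
    rcases hY with hY | hY
    · left
      refine ⟨?_, Or.inl ⟨hX.1.mono Set.subset_union_left, ?_, ?_⟩⟩
      · rw [Set.disjoint_left]
        intro v hvX hvY
        exact (Set.ext_iff.1 hY.2.1 v).1 ⟨hvY, Or.inr hvX⟩
      · ext v
        have h₁ := Set.ext_iff.1 hX.2.1 v
        have h₂ := Set.ext_iff.1 hY.2.1 v
        simp at h₁ h₂ ⊢
        tauto
      · rw [← Set.union_assoc]
        exact hY.2.2
    · right
      rcases Set.eq_empty_or_nonempty (Y \ X) with h | h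
      · exact Or.inl h
      refine Or.inr (Or.inr ⟨h, ?_, ?_⟩)
      · rintro v ⟨hvY, hvX⟩
        exact (hY.2.1 hvY).resolve_right hvX
      · convert hY.2.2.inter hC using 1
        ext v
        have h₁ := Set.ext_iff.1 hX.2.1 v
        simp at h₁ ⊢
        tauto
  · rw [if_neg fun h' => h'.not_validNeg hX] at hY
    rcases hY with hY | hY
    · right
      rcases Set.eq_empty_or_nonempty (Y \ X) with h | h
      · exact Or.inl h
      refine Or.inr (Or.inl ⟨h, ?_, ?_⟩)
      · ext v
        have h₂ := Set.ext_iff.1 hY.2.1 v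
        simp at h₂ ⊢
        tauto
      · convert hC.union hY.2.2 using 1
        ext v
        have h₁ := @hX.2.1 v
        simp
        tauto
    · left
      refine ⟨?_, Or.inr ⟨hX.1.mono Set.subset_union_left, ?_, ?_⟩⟩
      · rw [Set.disjoint_left]
        intro v hvX hvY
        exact (hY.2.1 hvY).2 hvX
      · exact Set.union_subset hX.2.1 (hY.2.1.trans Set.sdiff_subset)
      · rw [← Set.sdiff_sdiff]
        exact hY.2.2

end RTree

namespace TCPhase

variable {V : Type} [Fintype V] [DecidableEq V]
  {T : RTree V} {α : ℕ} {req : ℕ → Request V}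

theorem cache_succ_of_some (E : TCPhase T α req) {t : ℕ} {X : Set V} (h : E.chg t = some X) :
    E.cache (t + 1) = T.applyChg (E.cache t) X :=
  (E.step_some t X h).2.2.2

theorem cache_change_iff (E : TCPhase T α req) (t : ℕ) (v : V) :
    (¬ (v ∈ E.cache t ↔ v ∈ E.cache (t + 1))) ↔ ∃ X, E.chg t = some X ∧ v ∈ X := by
  cases h : E.chg t with
  | none => simp [(E.step_none t h).1]
  | some X =>
    rw [E.cache_succ_of_some h, T.mem_applyChg_iff (E.step_some t X h).1]
    by_cases hv : v ∈ X <;> simp [hv]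

theorem GoodReq.costly {E : TCPhase T α req} (hgood : E.GoodReq) {t : ℕ} (ht : 1 ≤ t) :
    Costly (req t) (E.cache t) := by
  obtain ⟨h₁, h₂⟩ := hgood t ht
  cases h : (req t).2
  · exact Or.inr ⟨h, h₂ h⟩
  · exact Or.inl ⟨h, h₁ h⟩

theorem cnt_succ {E : TCPhase T α req} (hgood : E.GoodReq) (t : ℕ) (v : V) :
    E.cnt (t + 1) v = E.cntPost t v + if (req (t + 1)).1 = v then 1 else 0 := by
  rw [E.cnt_rec, cntPost]
  congr 1
  simp [hgood.costly (Nat.le_add_left 1 t)]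

/-- No valid changeset is over-saturated, and it is unsaturated if the
last request was issued outside of it. -/
theorem cntSum_cnt_le {E : TCPhase T α req} (hα : 1 ≤ α) (hgood : E.GoodReq) (t : ℕ) :
    ∀ Y, T.Valid (E.cache t) Y →
      cntSum (E.cnt t) Y + (if (req t).1 ∈ Y then 0 else 1) ≤ Y.ncard * α := by
  induction t with
  | zero =>
    intro Y hY
    rw [cntSum_eq_zero fun v _ => E.cnt_zero v]
    have : 0 < Y.ncard * α := Nat.mul_pos (hY.nonempty.ncard_pos (Set.toFinite Y)) hα
    split <;> omega
  | succ t ih =>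
    intro Y hY
    have hcnt : cntSum (E.cnt (t + 1)) Y
        = cntSum (E.cntPost t) Y + if (req (t + 1)).1 ∈ Y then 1 else 0 := by
      rw [← cntSum_single, ← cntSum_add]
      exact cntSum_congr fun v _ => cnt_succ hgood t v
    suffices cntSum (E.cntPost t) Y < Y.ncard * α by
      rw [hcnt]
      split <;> omega
    cases h : E.chg t with
    | none =>
      obtain ⟨hc, hlt⟩ := E.step_none t h
      rw [hc] at hY
      convert hlt Y hY using 1
      exact cntSum_congr fun v _ => by simp [cntPost, h]
    | some X =>
      obtain ⟨hX, hsat, hmax, -⟩ := E.step_some t X h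
      rw [E.cache_succ_of_some h] at hY
      have hpost : ∀ v, E.cntPost t v = if v ∈ X then 0 else E.cnt t v := by
        intro v
        simp [cntPost, h]
      have hdiff : cntSum (E.cntPost t) Y = cntSum (E.cnt t) (Y \ X) := by
        rw [← Set.sdiff_union_inter Y X,
          cntSum_union _ (Set.disjoint_sdiff_left.mono_right Set.inter_subset_right),
          cntSum_eq_zero (A := Y ∩ X) fun v hv => by rw [hpost, if_pos hv.2],
          Set.sdiff_union_inter]
        exact cntSum_congr fun v hv => by rw [hpost, if_neg hv.2]
      have hYpos : 0 < Y.ncard * α :=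
        Nat.mul_pos (hY.nonempty.ncard_pos (Set.toFinite Y)) hα
      rw [hdiff]
      rcases hX.of_applyChg (E.cache_subforest t) hY with ⟨hd, hXY⟩ | hE | hV
      · have hlt := hmax _ hXY (by
          refine Set.ssubset_iff_subset_ne.2 ⟨Set.subset_union_left, fun he => ?_⟩
          obtain ⟨v, hv⟩ := hY.nonempty
          exact Set.disjoint_left.1 hd (he ▸ Or.inr hv) hv)
        rw [cntSum_union _ hd, Set.ncard_union_eq hd, add_mul] at hlt
        rw [hd.symm.sdiff_eq_left]
        omega
      · rw [hE, cntSum_eq_zero (by simp)]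
        exact hYpos
      · have h₁ := ih _ hV
        have h₂ := ih _ hX
        by_cases hYX : Y \ X = Y
        · have hmem : (req t).1 ∈ X := by
            by_contra hc
            rw [if_neg hc] at h₂
            omega
          rw [if_neg fun hc => hc.2 hmem, hYX] at h₁
          rw [hYX]
          omega
        · have hlt : (Y \ X).ncard < Y.ncard :=
            Set.ncard_lt_ncard (Set.ssubset_iff_subset_ne.2 ⟨Set.sdiff_subset, hYX⟩)
              (Set.toFinite Y)
          have := Nat.mul_lt_mul_of_pos_right hlt hα
          omega

theorem lastChg_succ (E : TCPhase T α req) (v : V) (t : ℕ) :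
    E.lastChg v (t + 1) =
      if ∃ X, E.chg t = some X ∧ v ∈ X then t else E.lastChg v t := by
  unfold lastChg
  rw [Finset.range_add_one, Finset.filter_insert]
  simp only [E.cache_change_iff]
  split
  · rw [Finset.sup_insert, id, sup_eq_left, Finset.sup_le_iff]
    intro s hs
    exact (Finset.mem_range.1 (Finset.mem_filter.1 hs).1).le
  · rfl

theorem lastChg_le (E : TCPhase T α req) (v : V) (t : ℕ) : E.lastChg v t ≤ t :=
  Finset.sup_le fun _ hs => (Finset.mem_range.1 (Finset.mem_filter.1 hs).1).le

theorem mem_cache_iff_of_lastChg_lt (E : TCPhase T α req) {v : V} {r t : ℕ}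
    (hlt : E.lastChg v t < r) (hle : r ≤ t) : v ∈ E.cache r ↔ v ∈ E.cache t := by
  induction t, hle using Nat.le_induction with
  | base => rfl
  | succ t hrt ih =>
    rw [E.lastChg_succ] at hlt
    split at hlt
    · omega
    · rename_i hno
      rw [← E.cache_change_iff, not_not] at hno
      exact (ih hlt).trans hno

/-- The counter of `v` is the number of requests to `v` since its last state change. -/
theorem cnt_eq_card {E : TCPhase T α req} (hgood : E.GoodReq) (v : V) (t : ℕ) :
    E.cnt t v =
      ((Finset.Icc 1 t).filter fun r => (req r).1 = v ∧ E.lastChg v t < r).card := by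
  induction t with
  | zero => simp [E.cnt_zero]
  | succ t ih =>
    have hle := E.lastChg_le v t
    rw [cnt_succ hgood, cntPost, ← Finset.insert_Icc_right_eq_Icc_add_one (by omega),
      Finset.filter_insert, E.lastChg_succ]
    split
    · have he : ((Finset.Icc 1 t).filter fun r => (req r).1 = v ∧ t < r) = ∅ := by
        refine Finset.filter_eq_empty_iff.2 fun r hr => ?_
        have := (Finset.mem_Icc.1 hr).2
        omega
      rw [he]
      by_cases hv : (req (t + 1)).1 = v <;> simp [hv]
    · rw [ih]
      by_cases hv : (req (t + 1)).1 = v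
      · rw [if_pos hv, if_pos ⟨hv, by omega⟩, Finset.card_insert_of_notMem (by simp)]
      · simp [hv]

theorem fieldReq_eq_cntSum {E : TCPhase T α req} (hgood : E.GoodReq) {t : ℕ} {X : Set V}
    (hchg : E.chg t = some X) : E.fieldReq req t = cntSum (E.cnt t) X := by
  unfold fieldReq fieldReqIn cntSum
  rw [Finset.card_eq_sum_card_fiberwise (f := fun r => (req r).1) (t := Finset.univ)
    (fun _ _ => Finset.mem_coe.2 (Finset.mem_univ _))]
  refine Finset.sum_congr rfl fun v _ => ?_
  rw [Set.indicator_apply]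
  split
  · rename_i hv
    rw [cnt_eq_card hgood]
    refine congrArg Finset.card (Finset.ext fun r => ?_)
    simp only [Finset.mem_filter]
    constructor
    · rintro ⟨⟨hr, -, -, -, -, -, h, -⟩, rfl⟩
      exact ⟨hr, rfl, h⟩
    · rintro ⟨hr, rfl, h⟩
      have := (Finset.mem_Icc.1 hr).2
      exact ⟨⟨hr, this, Set.mem_univ _, X, hchg, hv, h, this⟩, rfl⟩
  · rename_i hv
    refine Finset.card_eq_zero.2 (Finset.eq_empty_of_forall_notMem fun r => ?_)
    simp only [Finset.mem_filter]
    rintro ⟨⟨-, -, -, Z, hZ, hvZ, -⟩, rfl⟩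
    rw [hchg, Option.some_inj] at hZ
    exact hv (hZ ▸ hvZ)

end TCPhase

/-- for every field `F^t` of a phase of `TC`,
`req(F^t) = size(F^t) · α`; moreover all requests in slots of `F^t` are positive if the
field is positive and negative if the field is negative. -/
theorem field_requests {V : Type} [Fintype V] [DecidableEq V]
    {T : RTree V} {α : ℕ} {req : ℕ → Request V}
    (E : TCPhase T α req) (hα : 1 ≤ α) (hgood : E.GoodReq)
    (t : ℕ) (X : Set V) (hchg : E.chg t = some X) :
    E.fieldReq req t = X.ncard * α ∧
    (T.ValidPos (E.cache t) X →
      ∀ r ∈ Finset.Icc 1 t, E.inField t (req r).1 r → (req r).2 = true) ∧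
    (T.ValidNeg (E.cache t) X →
      ∀ r ∈ Finset.Icc 1 t, E.inField t (req r).1 r → (req r).2 = false) := by
  obtain ⟨hX, hsat, -, -⟩ := E.step_some t X hchg
  refine ⟨?_, ?_, ?_⟩
  · rw [TCPhase.fieldReq_eq_cntSum hgood hchg]
    have := TCPhase.cntSum_cnt_le hα hgood t X hX
    omega
  · rintro hpos r hr ⟨Z, hZ, hvZ, hlt, hle⟩
    rw [hchg, Option.some_inj] at hZ
    subst hZ
    rw [← Bool.not_eq_false]
    intro hf
    have hmem := (hgood r (Finset.mem_Icc.1 hr).1).2 hf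
    rw [E.mem_cache_iff_of_lastChg_lt hlt hle] at hmem
    exact (Set.ext_iff.1 hpos.2.1 _).1 ⟨hvZ, hmem⟩
  · rintro hneg r hr ⟨Z, hZ, hvZ, hlt, hle⟩
    rw [hchg, Option.some_inj] at hZ
    subst hZ
    rw [← Bool.not_eq_true]
    intro hf
    have hmem := (hgood r (Finset.mem_Icc.1 hr).1).1 hf
    rw [E.mem_cache_iff_of_lastChg_lt hlt hle] at hmem
    exact hmem (hneg.2.1 hvZ)
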